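/- Let (Σ,σ) be a topologically transitive countable Markov shift with the F-property, and let φ : Σ → ℝ have summable variations and Gurevich pressure P(φ) < ∞. Then the following are equivalent: (UCS) χ_per(φ) := sup{(1/n)S_nφ(x) : σ^n x = x, n ∈ ℕ} < P(φ); (CRC) for every q ∈ ℕ there exist C_q ∈ ℝ and ε_q > 0 such that for all n ∈ ℕ, every x ∈ Σ with x_0 ≤ q and x_n ≤ q satisfies S_nφ(x) ≤ C_q + n(P(φ) − ε_q); (CI) δ_{φ,∞} < P(φ). -/

import Mathlib

open Filter Set MeasureTheory Real ENNReal

namespace CMS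

/-- Points of the full sequence space over the alphabet `ℕ`. -/
abbrev Pt : Type := ℕ → ℕ

/-- The (left) shift map `σ`. -/
def shiftMap : Pt → Pt := fun x i => x (i + 1)

/-- `x` is a point of the countable Markov shift `Σ` determined by the
transition matrix `M` (identified with a relation on the alphabet `ℕ`). -/
def isAdmissible (M : ℕ → ℕ → Prop) (x : Pt) : Prop := ∀ i, M (x i) (x (i + 1))

/-- Topological transitivity: for all states `a, b` there is `N` with
`[a] ∩ σ⁻ᴺ [b] ≠ ∅`. -/
def TopTransitive (M : ℕ → ℕ → Prop) : Prop :=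
  ∀ a b : ℕ, ∃ (N : ℕ) (x : Pt), isAdmissible M x ∧ x 0 = a ∧ x N = b

/-- Birkhoff sum `S_n φ`. -/
noncomputable def birkhoff (φ : Pt → ℝ) (n : ℕ) (x : Pt) : ℝ :=
  ∑ i ∈ Finset.range n, φ (shiftMap^[i] x)

/-- `φ` has summable variations: `∑_{k ≥ 2} var_k(φ) < ∞`, expressed via a summable
sequence dominating the `k`-th variations. -/
def SummableVariations (M : ℕ → ℕ → Prop) (φ : Pt → ℝ) : Prop :=
  ∃ V : ℕ → ℝ, Summable V ∧
    ∀ k, 2 ≤ k → ∀ x y : Pt, isAdmissible M x → isAdmissible M y →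
      (∀ i < k, x i = y i) → |φ x - φ y| ≤ V k

/-- `φ` is weakly Hölder continuous: `var_k(φ) ≤ C θ^k` for all `k ≥ 2`. -/
def WeaklyHolder (M : ℕ → ℕ → Prop) (φ : Pt → ℝ) : Prop :=
  ∃ C θ : ℝ, 0 < C ∧ 0 < θ ∧ θ < 1 ∧
    ∀ k, 2 ≤ k → ∀ x y : Pt, isAdmissible M x → isAdmissible M y →
      (∀ i < k, x i = y i) → |φ x - φ y| ≤ C * θ ^ k

/-- Periodic points of period `n` in the 1-cylinder `[a]`. -/
def PerSet (M : ℕ → ℕ → Prop) (a n : ℕ) : Set Pt :=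
  {x | isAdmissible M x ∧ shiftMap^[n] x = x ∧ x 0 = a}

/-- Periodic points of period `n` in `[a]` whose first return time to `[a]` is `n`. -/
def PerStarSet (M : ℕ → ℕ → Prop) (a n : ℕ) : Set Pt :=
  {x | isAdmissible M x ∧ shiftMap^[n] x = x ∧ x 0 = a ∧ ∀ k, 0 < k → k < n → x k ≠ a}

/-- The Gurevich partition function `Z_n(φ, a)`. -/
noncomputable def Zn (M : ℕ → ℕ → Prop) (φ : Pt → ℝ) (a n : ℕ) : ℝ≥0∞ :=
  ∑' x : PerSet M a n, ENNReal.ofReal (Real.exp (birkhoff φ n x.1))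

/-- The first-return partition function `Z_n^*(φ, a)`. -/
noncomputable def ZnStar (M : ℕ → ℕ → Prop) (φ : Pt → ℝ) (a n : ℕ) : ℝ≥0∞ :=
  ∑' x : PerStarSet M a n, ENNReal.ofReal (Real.exp (birkhoff φ n x.1))

/-- The Gurevich pressure at the state `a`:
`P(φ) = limsup_n (1/n) log Z_n(φ, a)`, with values in `EReal`. -/
noncomputable def pressureAt (M : ℕ → ℕ → Prop) (φ : Pt → ℝ) (a : ℕ) : EReal :=
  Filter.limsup (fun n : ℕ => ((n : ℝ)⁻¹ : EReal) * ENNReal.log (Zn M φ a n)) atTop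

/-- `limsup_n (1/n) log Z_n^*(φ, a)`, with values in `EReal`. -/
noncomputable def pressureStarAt (M : ℕ → ℕ → Prop) (φ : Pt → ℝ) (a : ℕ) : EReal :=
  Filter.limsup (fun n : ℕ => ((n : ℝ)⁻¹ : EReal) * ENNReal.log (ZnStar M φ a n)) atTop

/-- Strong positive recurrence of `φ`, relative to the common value `P` of the
Gurevich pressure: for some state `a`, `limsup_n (1/n) log Z_n^*(φ,a) < P(φ)`. -/
def SPR (M : ℕ → ℕ → Prop) (φ : Pt → ℝ) (P : ℝ) : Prop :=
  ∃ a : ℕ, pressureStarAt M φ a < (P : EReal)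

/-- The `F`-property: for every state `a` and every `n ≥ 1` there are only finitely
many periodic points of period `n` in `[a]`. -/
def FProperty (M : ℕ → ℕ → Prop) : Prop :=
  ∀ a n : ℕ, 0 < n → (PerSet M a n).Finite

/-- `χ_per(φ) = sup { (1/n) S_n φ(x) : σ^n x = x, n ∈ ℕ }`, with values in `EReal`. -/
noncomputable def chiPer (M : ℕ → ℕ → Prop) (φ : Pt → ℝ) : EReal :=
  ⨆ p : {p : Pt × ℕ // isAdmissible M p.1 ∧ 0 < p.2 ∧ shiftMap^[p.2] p.1 = p.1},
    ((birkhoff φ p.1.2 p.1.1 / (p.1.2 : ℝ) : ℝ) : EReal)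

/-- `x` lies in a cylinder belonging to `B(n, M', q)`: it is admissible,
`x 0 ≤ q`, `x n ≤ q` and `#{0 ≤ k ≤ n : x k ≤ q} ≤ (n+1)/M'`. -/
def inBSet (M : ℕ → ℕ → Prop) (n M' q : ℕ) (x : Pt) : Prop :=
  isAdmissible M x ∧ x 0 ≤ q ∧ x n ≤ q ∧
    ((((Finset.range (n + 1)).filter (fun k => x k ≤ q)).card : ℝ) ≤ (n + 1 : ℝ) / (M' : ℝ))

/-- `z_{φ,n}(M',q) = sup { (1/n) S_n φ(x) : x ∈ B for some B ∈ B(n,M',q) }`. -/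
noncomputable def zPhi (M : ℕ → ℕ → Prop) (φ : Pt → ℝ) (n M' q : ℕ) : EReal :=
  ⨆ x : {x : Pt // inBSet M n M' q x}, ((birkhoff φ n x.1 / (n : ℝ) : ℝ) : EReal)

/-- The contraction at infinity
`δ_{φ,∞} = lim_{q→∞} lim_{M'→∞} limsup_{n→∞} z_{φ,n}(M',q)`
(the inner limits exist by monotonicity, so they agree with `liminf`s). -/
noncomputable def deltaInf (M : ℕ → ℕ → Prop) (φ : Pt → ℝ) : EReal :=
  liminf (fun q : ℕ => liminf (fun M' : ℕ =>
    limsup (fun n : ℕ => zPhi M φ n M' q) atTop) atTop) atTop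

/-- `z_n(M',q) = #B(n,M',q)`, the number of `(n+1)`-cylinders (i.e. admissible
words realized in `Σ`) in `B(n,M',q)`, counted in `ℝ≥0∞`. -/
noncomputable def zCount (M : ℕ → ℕ → Prop) (n M' q : ℕ) : ℝ≥0∞ :=
  ∑' _w : {w : Fin (n + 1) → ℕ //
      (∃ x : Pt, isAdmissible M x ∧ ∀ i : Fin (n + 1), x (i : ℕ) = w i) ∧
      w 0 ≤ q ∧ w (Fin.last n) ≤ q ∧
      (((Finset.univ.filter (fun i : Fin (n + 1) => w i ≤ q)).card : ℝ) ≤ (n + 1 : ℝ) / (M' : ℝ))},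
    (1 : ℝ≥0∞)

/-- The entropy at infinity
`h_∞ = lim_{q→∞} lim_{M'→∞} limsup_{n→∞} (1/n) log z_n(M',q)`. -/
noncomputable def hInfty (M : ℕ → ℕ → Prop) : EReal :=
  liminf (fun q : ℕ => liminf (fun M' : ℕ =>
    limsup (fun n : ℕ => ((n : ℝ)⁻¹ : EReal) * ENNReal.log (zCount M n M' q)) atTop) atTop) atTop

end CMS

open CMS

namespace CMS

section

variable {M : ℕ → ℕ → Prop} {φ : Pt → ℝ}

lemma shiftMap_iterate_apply (n i : ℕ) (x : Pt) : shiftMap^[n] x i = x (i + n) := by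
  induction n generalizing x with
  | zero => rfl
  | succ n ih =>
    rw [Function.iterate_succ_apply, ih]
    simp [shiftMap, add_assoc]

lemma isAdmissible.iterate {x : Pt} (hx : isAdmissible M x) (n : ℕ) :
    isAdmissible M (shiftMap^[n] x) := by
  intro i
  rw [shiftMap_iterate_apply, shiftMap_iterate_apply, add_right_comm]
  exact hx _

lemma birkhoff_add (φ : Pt → ℝ) (m n : ℕ) (x : Pt) :
    birkhoff φ (m + n) x = birkhoff φ m x + birkhoff φ n (shiftMap^[m] x) := by
  simp only [birkhoff, Finset.sum_range_add, ← Function.iterate_add_apply, add_comm]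

/-- `B` bounds the difference of two Birkhoff sums along a common cylinder. -/
def DistortionBound (M : ℕ → ℕ → Prop) (φ : Pt → ℝ) (B : ℝ) : Prop :=
  ∀ (n : ℕ) (x y : Pt), isAdmissible M x → isAdmissible M y →
    (∀ i ≤ n, x i = y i) → birkhoff φ n x ≤ birkhoff φ n y + B

lemma SummableVariations.exists_distortionBound (h : SummableVariations M φ) :
    ∃ B, DistortionBound M φ B := by
  obtain ⟨V, hV, hvar⟩ := h
  refine ⟨∑' k, |V k|, fun n x y hx hy hxy => ?_⟩
  have hterm : ∀ i ∈ Finset.range n,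
      φ (shiftMap^[i] x) - φ (shiftMap^[i] y) ≤ |V (n + 1 - i)| := by
    intro i hi
    have hi := Finset.mem_range.1 hi
    refine (le_abs_self _).trans ((hvar (n + 1 - i) (by omega) _ _ (hx.iterate i) (hy.iterate i)
      fun j hj => ?_).trans (le_abs_self _))
    rw [shiftMap_iterate_apply, shiftMap_iterate_apply]
    exact hxy _ (by omega)
  have hsum : ∑ i ∈ Finset.range n, |V (n + 1 - i)| ≤ ∑' k, |V k| := by
    rw [← Finset.sum_image (f := fun k => |V k|) (g := fun i => n + 1 - i)]
    · exact hV.abs.sum_le_tsum _ fun _ _ => abs_nonneg _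
    · intro i hi j hj hij
      simp only [Finset.coe_range, Set.mem_Iio] at hi hj hij
      omega
  have := Finset.sum_le_sum hterm
  rw [Finset.sum_sub_distrib] at this
  simp only [birkhoff]
  linarith

/-- The point following `x` up to time `n` and `y` from then on. -/
def splice (n : ℕ) (x y : Pt) : Pt := fun t => if t < n then x t else y (t - n)

lemma splice_of_le {n t : ℕ} {x y : Pt} (h : x n = y 0) (ht : t ≤ n) : splice n x y t = x t := by
  rcases ht.lt_or_eq with ht | rfl
  · simp [splice, ht]
  · simp [splice, h]

lemma splice_add (n t : ℕ) (x y : Pt) : splice n x y (t + n) = y t := by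
  simp [splice]

lemma splice_of_ge {n t : ℕ} (x y : Pt) (ht : n ≤ t) : splice n x y t = y (t - n) := by
  simp [splice, ht.not_gt]

lemma shiftMap_iterate_splice (n : ℕ) (x y : Pt) : shiftMap^[n] (splice n x y) = y := by
  funext i
  rw [shiftMap_iterate_apply, splice_add]

lemma isAdmissible.splice {n : ℕ} {x y : Pt} (hx : isAdmissible M x) (hy : isAdmissible M y)
    (h : x n = y 0) : isAdmissible M (splice n x y) := by
  intro t
  rcases lt_or_ge t n with ht | ht
  · rw [splice_of_le h ht.le, splice_of_le h ht]
    exact hx t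
  · rw [splice_of_ge _ _ ht, splice_of_ge _ _ (ht.trans t.le_succ), Nat.succ_sub ht]
    exact hy _

lemma DistortionBound.le_birkhoff_splice {B : ℝ} (hB : DistortionBound M φ B) {n : ℕ} {x y : Pt}
    (hx : isAdmissible M x) (hy : isAdmissible M y) (h : x n = y 0) (m : ℕ) :
    birkhoff φ n x + birkhoff φ m y ≤ birkhoff φ (n + m) (CMS.splice n x y) + B := by
  rw [birkhoff_add, shiftMap_iterate_splice]
  have := hB n x (CMS.splice n x y) hx (hx.splice hy h) fun i hi => (splice_of_le h hi).symm
  linarith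

/-- The point of period `n` with the same first `n` symbols as `x`. -/
def periodize (n : ℕ) (x : Pt) : Pt := fun t => x (t % n)

lemma shiftMap_iterate_periodize (n : ℕ) (x : Pt) :
    shiftMap^[n] (periodize n x) = periodize n x := by
  funext i
  simp [shiftMap_iterate_apply, periodize]

lemma periodize_of_le {n t : ℕ} {x : Pt} (h : x n = x 0) (ht : t ≤ n) :
    periodize n x t = x t := by
  rcases ht.lt_or_eq with ht | rfl
  · simp [periodize, Nat.mod_eq_of_lt ht]
  · simp [periodize, h]

lemma isAdmissible.periodize {n : ℕ} {x : Pt} (hx : isAdmissible M x) (hn : 0 < n)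
    (h : x n = x 0) : isAdmissible M (periodize n x) := by
  intro t
  have h1 : CMS.periodize n x (t + 1) = x (t % n + 1) := by
    have ht := Nat.mod_lt t hn
    rw [← periodize_of_le h (Nat.succ_le_of_lt ht)]
    simp [CMS.periodize]
  rw [h1]
  exact hx _

/-- The periodic point obtained by following `x` for time `n` and then `y` for time `r`. -/
def closeUp (n r : ℕ) (x y : Pt) : Pt := periodize (n + r) (splice n x y)

section closeUp

variable {n r : ℕ} {x y : Pt}

lemma splice_closes (h : x n = y 0) (h' : y r = x 0) :
    splice n x y (n + r) = splice n x y 0 := by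
  rw [splice_of_ge _ _ (Nat.le_add_right n r), splice_of_le h (Nat.zero_le n),
    Nat.add_sub_cancel_left, h']

lemma closeUp_of_le (h : x n = y 0) (h' : y r = x 0) {t : ℕ} (ht : t ≤ n) :
    closeUp n r x y t = x t := by
  rw [closeUp, periodize_of_le (splice_closes h h') (by omega), splice_of_le h ht]

lemma closeUp_mem_perSet (hx : isAdmissible M x) (hy : isAdmissible M y) (hr : 0 < r)
    (h : x n = y 0) (h' : y r = x 0) : closeUp n r x y ∈ PerSet M (x 0) (n + r) :=
  ⟨(hx.splice hy h).periodize (by omega) (splice_closes h h'),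
    shiftMap_iterate_periodize _ _, closeUp_of_le h h' (Nat.zero_le n)⟩

lemma DistortionBound.le_birkhoff_closeUp {B : ℝ} (hB : DistortionBound M φ B)
    (hx : isAdmissible M x) (hy : isAdmissible M y) (hr : 0 < r)
    (h : x n = y 0) (h' : y r = x 0) :
    birkhoff φ n x + birkhoff φ r y ≤ birkhoff φ (n + r) (closeUp n r x y) + 2 * B := by
  have h1 := hB.le_birkhoff_splice hx hy h r
  have h2 := hB (n + r) (splice n x y) (closeUp n r x y) (hx.splice hy h)
    (closeUp_mem_perSet hx hy hr h h').1
    fun i hi => (periodize_of_le (splice_closes h h') hi).symm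
  linarith

end closeUp

lemma TopTransitive.exists_path (h : TopTransitive M) (a b : ℕ) :
    ∃ (r : ℕ) (y : Pt), isAdmissible M y ∧ 0 < r ∧ y 0 = a ∧ y r = b := by
  obtain ⟨n, x, hx, hx0, hxn⟩ := h a (b + a + 1)
  obtain ⟨m, y, hy, hy0, hym⟩ := h (b + a + 1) b
  have hxy : x n = y 0 := hxn.trans hy0.symm
  refine ⟨n + m, splice n x y, hx.splice hy hxy, ?_, ?_, ?_⟩
  · rcases Nat.eq_zero_or_pos n with rfl | hn
    · omega
    · omega
  · rw [splice_of_le hxy (Nat.zero_le n), hx0]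
  · rw [splice_of_ge _ _ (Nat.le_add_right n m), Nat.add_sub_cancel_left, hym]

/-- `u` starts with a first-return loop of length `l` at the state `a`. -/
structure IsFirstLoop (M : ℕ → ℕ → Prop) (a l : ℕ) (u : Pt) : Prop where
  adm : isAdmissible M u
  pos : 0 < l
  zero : u 0 = a
  last : u l = a
  ne : ∀ i, 0 < i → i < l → u i ≠ a

lemma TopTransitive.exists_isFirstLoop (h : TopTransitive M) {a b : ℕ} (hab : b ≠ a) :
    ∃ (l t : ℕ) (u : Pt), IsFirstLoop M a l u ∧ 0 < t ∧ t < l ∧ u t = b := by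
  classical
  have hN := h a b
  obtain ⟨x, hx, hx0, hxN⟩ := Nat.find_spec hN
  set N := Nat.find hN with hNdef
  have hxne : ∀ i, 0 < i → i ≤ N → x i ≠ a := by
    intro i hi hiN hxi
    refine Nat.find_min hN (m := N - i) (by omega)
      ⟨shiftMap^[i] x, hx.iterate i, by simpa [shiftMap_iterate_apply] using hxi, ?_⟩
    rw [shiftMap_iterate_apply, Nat.sub_add_cancel hiN, hxN]
  obtain ⟨K, y, hy, hy0, hyK⟩ := h b a
  have hK : ∃ k, y k = a := ⟨K, hyK⟩
  set k := Nat.find hK with hkdef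
  have hyk : y k = a := Nat.find_spec hK
  have hyne : ∀ i < k, y i ≠ a := fun i hi => Nat.find_min hK hi
  have hxy : x N = y 0 := hxN.trans hy0.symm
  have hN0 : 0 < N := by
    rcases Nat.eq_zero_or_pos N with h0 | h0
    · rw [h0, hx0] at hxN
      exact absurd hxN.symm hab
    · exact h0
  have hk0 : 0 < k := by
    rcases Nat.eq_zero_or_pos k with h0 | h0
    · rw [h0, hy0] at hyk
      exact absurd hyk hab
    · exact h0
  refine ⟨N + k, N, splice N x y, ⟨hx.splice hy hxy, by omega, ?_, ?_, ?_⟩, hN0, by omega, ?_⟩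
  · rw [splice_of_le hxy (Nat.zero_le _), hx0]
  · rw [splice_of_ge _ _ (Nat.le_add_right N k), Nat.add_sub_cancel_left, hyk]
  · intro i hi hil
    rcases le_or_gt i N with hiN | hiN
    · rw [splice_of_le hxy hiN]
      exact hxne i hi hiN
    · rw [splice_of_ge _ _ hiN.le]
      exact hyne _ (by omega)
  · rw [splice_of_le hxy le_rfl, hxN]

/-- The word `x_i … x_{i+l}` agrees with `u_0 … u_l`. -/
def Reads (l : ℕ) (u x : Pt) (i : ℕ) : Prop := ∀ t ≤ l, x (i + t) = u t

lemma TopTransitive.exists_two_isFirstLoop (h : TopTransitive M) (a : ℕ) :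
    ∃ (l l' : ℕ) (u u' : Pt), IsFirstLoop M a l u ∧ IsFirstLoop M a l' u' ∧
      ∀ x i, ¬ (Reads l u x i ∧ Reads l' u' x i) := by
  obtain ⟨l, -, u, hu, -⟩ := h.exists_isFirstLoop (Nat.succ_ne_self a)
  obtain ⟨b, hb⟩ := Infinite.exists_notMem_finset ((Finset.range (l + 1)).image u)
  have hb' : ∀ t ≤ l, u t ≠ b := fun t ht htb =>
    hb (Finset.mem_image.2 ⟨t, Finset.mem_range.2 (by omega), htb⟩)
  have hba : b ≠ a := fun hba => hb' 0 (Nat.zero_le _) (hu.zero.trans hba.symm)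
  obtain ⟨l', t, u', hu', ht0, htl, hut⟩ := h.exists_isFirstLoop hba
  refine ⟨l, l', u, u', hu, hu', fun x i ⟨h1, h2⟩ => ?_⟩
  rcases le_or_gt t l with htl' | htl'
  · exact hb' t htl' (by rw [← h1 t htl', h2 t htl.le, hut])
  · exact hu'.ne l hu.pos (by omega) (by rw [← h2 l (by omega), h1 l le_rfl, hu.last])

/-- Insert the loop `u_0 … u_l` into `z` at time `i`. -/
def insertLoop (l : ℕ) (u : Pt) (i : ℕ) (z : Pt) : Pt :=
  splice i z (splice l u (shiftMap^[i] z))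

section insertLoop

variable {a l i : ℕ} {u z : Pt}

lemma IsFirstLoop.splice_closes (hu : IsFirstLoop M a l u) (hz : z i = a) :
    u l = (shiftMap^[i] z) 0 := by
  rw [hu.last, shiftMap_iterate_apply, zero_add, hz]

lemma IsFirstLoop.splice_starts (hu : IsFirstLoop M a l u) (hz : z i = a) :
    z i = splice l u (shiftMap^[i] z) 0 := by
  rw [splice_of_le (hu.splice_closes hz) (Nat.zero_le _), hu.zero, hz]

lemma IsFirstLoop.insertLoop_of_le (hu : IsFirstLoop M a l u) (hz : z i = a) {t : ℕ}
    (ht : t ≤ i) : insertLoop l u i z t = z t :=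
  splice_of_le (hu.splice_starts hz) ht

lemma insertLoop_add {t : ℕ} (ht : i ≤ t) : insertLoop l u i z (t + l) = z t := by
  rw [insertLoop, splice_of_ge _ _ (by omega), Nat.sub_add_comm ht, splice_add,
    shiftMap_iterate_apply, Nat.sub_add_cancel ht]

lemma IsFirstLoop.reads_insertLoop (hu : IsFirstLoop M a l u) (hz : z i = a) :
    Reads l u (insertLoop l u i z) i := by
  intro t ht
  rw [insertLoop, splice_of_ge _ _ (Nat.le_add_right i t), Nat.add_sub_cancel_left,
    splice_of_le (hu.splice_closes hz) ht]

lemma IsFirstLoop.isAdmissible_insertLoop (hu : IsFirstLoop M a l u) (hz : z i = a)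
    (hadm : isAdmissible M z) : isAdmissible M (insertLoop l u i z) :=
  hadm.splice (hu.adm.splice (hadm.iterate i) (hu.splice_closes hz)) (hu.splice_starts hz)

lemma IsFirstLoop.insertLoop_injOn (hu : IsFirstLoop M a l u) :
    Set.InjOn (insertLoop l u i) {z | z i = a} := by
  intro z hz z' hz' h
  funext t
  rcases le_total t i with ht | ht
  · rw [← hu.insertLoop_of_le hz ht, h, hu.insertLoop_of_le hz' ht]
  · rw [← insertLoop_add (l := l) (u := u) (z := z) ht, h, insertLoop_add ht]

lemma shiftMap_iterate_insertLoop {m : ℕ} (hm : i ≤ m) :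
    shiftMap^[m + l] (insertLoop l u i z) = shiftMap^[m] z := by
  funext t
  rw [shiftMap_iterate_apply, shiftMap_iterate_apply, ← add_assoc, insertLoop_add (by omega)]

lemma DistortionBound.le_birkhoff_insertLoop {B : ℝ} (hB : DistortionBound M φ B)
    (hu : IsFirstLoop M a l u) (hz : z i = a) (hadm : isAdmissible M z) {m : ℕ} (hm : i ≤ m) :
    birkhoff φ m z + (birkhoff φ l u - 2 * B) ≤ birkhoff φ (m + l) (insertLoop l u i z) := by
  have h1 := hB.le_birkhoff_splice hadm
    (hu.adm.splice (hadm.iterate i) (hu.splice_closes hz)) (hu.splice_starts hz) (l + (m - i))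
  have h2 := hB.le_birkhoff_splice hu.adm (hadm.iterate i) (hu.splice_closes hz) (m - i)
  have h3 := birkhoff_add φ i (m - i) z
  rw [Nat.add_sub_cancel' hm] at h3
  rw [show i + (l + (m - i)) = m + l by omega] at h1
  rw [insertLoop]
  linarith

end insertLoop

/-- If `z` agrees with `x` up to the first element of `s`, which `x` reaches at the state `a`,
then `z` starts a copy of `u` before `s` only where `x` does. -/
lemma IsFirstLoop.reads_of_agree {a l i : ℕ} {u x z : Pt} (hu : IsFirstLoop M a l u)
    {s : Finset ℕ} (hs : ∀ j ∈ s, i < j ∧ x j = a) (hz : ∀ t, (∀ j ∈ s, t ≤ j) → z t = x t)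
    (hread : Reads l u z i) : Reads l u x i := by
  intro t
  induction t using Nat.strong_induction_on with
  | _ t ih =>
    intro ht
    rw [← hread t ht, hz]
    intro j hj
    obtain ⟨hij, hxj⟩ := hs j hj
    by_contra! hlt
    have := ih (j - i) (by omega) (by omega)
    rw [Nat.add_sub_cancel' hij.le, hxj] at this
    exact hu.ne (j - i) (by omega) (by omega) this.symm

/-- Inserting copies of a loop at the times in arbitrary subsets of `s` produces many orbit
segments, all of them distinct. -/
lemma DistortionBound.exists_insertions {B : ℝ} (hB : DistortionBound M φ B) {a l : ℕ} {u x : Pt}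
    (hu : IsFirstLoop M a l u) (hx : isAdmissible M x) (n : ℕ) (Q : ℝ) (s : Finset ℕ)
    (hs : ∀ i ∈ s, i ≤ n ∧ x i = a ∧ ¬ Reads l u x i) :
    ∃ H : Finset (Pt × ℕ),
      (∀ z ∈ H, isAdmissible M z.1 ∧ n ≤ z.2 ∧ shiftMap^[z.2] z.1 = shiftMap^[n] x ∧
        ∀ t, (∀ i ∈ s, t ≤ i) → z.1 t = x t) ∧
      (1 + exp (birkhoff φ l u - 2 * B - l * Q)) ^ s.card * exp (birkhoff φ n x - n * Q) ≤
        ∑ z ∈ H, exp (birkhoff φ z.2 z.1 - z.2 * Q) := by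
  classical
  induction s using Finset.induction_on_min with
  | empty => exact ⟨{(x, n)}, by simp [hx], by simp⟩
  | insert i s hi ih =>
    obtain ⟨H, hH, hsum⟩ := ih fun j hj => hs j (Finset.mem_insert_of_mem hj)
    obtain ⟨hin, hxi, hnr⟩ := hs i (Finset.mem_insert_self i s)
    have hzi : ∀ z ∈ H, z.1 i = a := fun z hz =>
      ((hH z hz).2.2.2 i fun j hj => (hi j hj).le).trans hxi
    let f : Pt × ℕ → Pt × ℕ := fun z => (insertLoop l u i z.1, z.2 + l)
    have hinj : Set.InjOn f H := by
      intro z hz z' hz' h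
      have h1 := hu.insertLoop_injOn (hzi z hz) (hzi z' hz') (congrArg Prod.fst h)
      have h2 : z.2 + l = z'.2 + l := congrArg Prod.snd h
      exact Prod.ext h1 (by omega)
    have hdisj : Disjoint H (H.image f) := by
      rw [Finset.disjoint_left]
      intro w hw hw'
      obtain ⟨z, hz, rfl⟩ := Finset.mem_image.1 hw'
      refine hnr (hu.reads_of_agree (s := s) (z := insertLoop l u i z.1) (fun j hj =>
        ⟨hi j hj, (hs j (Finset.mem_insert_of_mem hj)).2.1⟩) (hH _ hw).2.2.2 ?_)
      exact hu.reads_insertLoop (hzi z hz)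
    refine ⟨H ∪ H.image f, ?_, ?_⟩
    · intro w hw
      rcases Finset.mem_union.1 hw with hw | hw
      · obtain ⟨h1, h2, h3, h4⟩ := hH w hw
        exact ⟨h1, h2, h3, fun t ht => h4 t fun j hj => ht j (Finset.mem_insert_of_mem hj)⟩
      · obtain ⟨z, hz, rfl⟩ := Finset.mem_image.1 hw
        obtain ⟨h1, h2, h3, h4⟩ := hH z hz
        refine ⟨hu.isAdmissible_insertLoop (hzi z hz) h1, h2.trans (Nat.le_add_right _ _),
          (shiftMap_iterate_insertLoop (hin.trans h2)).trans h3, fun t ht => ?_⟩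
        exact (hu.insertLoop_of_le (hzi z hz) (ht i (Finset.mem_insert_self i s))).trans
          (h4 t fun j hj => ht j (Finset.mem_insert_of_mem hj))
    · rw [Finset.sum_union hdisj, Finset.sum_image hinj,
        Finset.card_insert_of_notMem fun h => (hi i h).ne rfl]
      have hterm : ∀ z ∈ H, exp (birkhoff φ l u - 2 * B - l * Q) *
          exp (birkhoff φ z.2 z.1 - z.2 * Q) ≤
            exp (birkhoff φ (f z).2 (f z).1 - (f z).2 * Q) := by
        intro z hz
        rw [← Real.exp_add]
        have := hB.le_birkhoff_insertLoop hu (hzi z hz) (hH z hz).1 (hin.trans (hH z hz).2.1)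
        simp only [f, Real.exp_le_exp, Nat.cast_add]
        linarith
      have h := Finset.sum_le_sum hterm
      rw [← Finset.mul_sum] at h
      have hc := Real.exp_pos (birkhoff φ l u - 2 * B - l * Q)
      rw [pow_succ]
      nlinarith

lemma sum_exp_birkhoff_le_Zn (φ : Pt → ℝ) {a m : ℕ} (F : Finset Pt)
    (hF : ∀ p ∈ F, p ∈ PerSet M a m) :
    ENNReal.ofReal (∑ p ∈ F, exp (birkhoff φ m p)) ≤ Zn M φ a m := by
  classical
  rw [ENNReal.ofReal_sum_of_nonneg fun _ _ => (Real.exp_pos _).le,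
    ← Finset.sum_subtype_of_mem _ hF]
  exact ENNReal.sum_le_tsum _

lemma Zn_ne_top_of_finite (φ : Pt → ℝ) {a m : ℕ} (h : (PerSet M a m).Finite) :
    Zn M φ a m ≠ ⊤ := by
  have := h.fintype
  rw [Zn, tsum_fintype]
  exact ENNReal.sum_ne_top.2 fun _ _ => ENNReal.ofReal_ne_top

lemma eventually_Zn_le {a : ℕ} {Q : ℝ} (h : pressureAt M φ a < (Q : EReal)) :
    ∀ᶠ m : ℕ in atTop, Zn M φ a m ≤ ENNReal.ofReal (exp (m * Q)) := by
  filter_upwards [eventually_lt_of_limsup_lt h, eventually_gt_atTop 0] with m hm hm0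
  have hm0' : (0 : EReal) < ((m : ℝ) : EReal) := by exact_mod_cast hm0
  rw [← ENNReal.log_le_log_iff, ENNReal.log_ofReal_of_pos (Real.exp_pos _), Real.log_exp]
  rw [← EReal.div_eq_inv_mul, EReal.div_lt_iff hm0' (EReal.coe_ne_top _)] at hm
  rw [mul_comm, EReal.coe_mul]
  exact hm.le

/-- Above the pressure, the weights of all periodic points through a state have a finite sum. -/
lemma FProperty.exists_sum_perSet_le (hF : FProperty M) {a : ℕ} {P Q : ℝ}
    (hP : pressureAt M φ a = (P : EReal)) (hPQ : P < Q) :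
    ∃ C : ℝ, ∀ H : Finset (Pt × ℕ), (∀ p ∈ H, 0 < p.2 ∧ p.1 ∈ PerSet M a p.2) →
      ∑ p ∈ H, exp (birkhoff φ p.2 p.1 - p.2 * Q) ≤ C := by
  classical
  obtain ⟨R, hPR, hRQ⟩ := exists_between hPQ
  let b : ℕ → ℝ := fun m => (Zn M φ a m).toReal * exp (-(m * Q))
  have hb0 : ∀ m, 0 ≤ b m := fun m => mul_nonneg ENNReal.toReal_nonneg (Real.exp_pos _).le
  have hb : Summable b := by
    have hgeo : Summable fun m : ℕ => exp (R - Q) ^ m :=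
      summable_geometric_of_lt_one (Real.exp_pos _).le (by simpa using hRQ)
    refine Summable.of_norm_bounded_eventually_nat hgeo ?_
    have hPR' : pressureAt M φ a < (R : EReal) := by
      rw [hP]
      exact_mod_cast hPR
    filter_upwards [eventually_Zn_le hPR'] with m hm
    rw [Real.norm_of_nonneg (hb0 m), ← Real.exp_nat_mul]
    calc b m ≤ exp (m * R) * exp (-(m * Q)) :=
          mul_le_mul_of_nonneg_right (ENNReal.toReal_le_of_le_ofReal (Real.exp_pos _).le hm)
            (Real.exp_pos _).le
      _ = exp (m * (R - Q)) := by rw [← Real.exp_add]; ring_nf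
  refine ⟨∑' m, b m, fun H hH => ?_⟩
  rw [← Finset.sum_fiberwise_of_maps_to (g := Prod.snd) (t := H.image Prod.snd)
    fun p hp => Finset.mem_image_of_mem _ hp]
  refine (Finset.sum_le_sum fun m hm => ?_).trans (hb.sum_le_tsum _ fun m _ => hb0 m)
  obtain ⟨p, hp, rfl⟩ := Finset.mem_image.1 hm
  set m := p.2
  have hinj : Set.InjOn Prod.fst (SetLike.coe (H.filter fun p => p.2 = m)) := by
    intro z hz z' hz' h
    have hz := (Finset.mem_filter.1 hz).2
    have hz' := (Finset.mem_filter.1 hz').2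
    exact Prod.ext h (hz.trans hz'.symm)
  have hle := sum_exp_birkhoff_le_Zn (M := M) φ (a := a) (m := m)
    ((H.filter fun p => p.2 = m).image Prod.fst) fun q hq => by
      obtain ⟨z, hz, rfl⟩ := Finset.mem_image.1 hq
      obtain ⟨hz, hzm⟩ := Finset.mem_filter.1 hz
      exact hzm ▸ (hH z hz).2
  rw [Finset.sum_image hinj,
    ENNReal.ofReal_le_iff_le_toReal (Zn_ne_top_of_finite φ (hF a m (hH p hp).1))] at hle
  calc ∑ z ∈ H with z.2 = m, exp (birkhoff φ z.2 z.1 - z.2 * Q)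
      = (∑ z ∈ H with z.2 = m, exp (birkhoff φ m z.1)) * exp (-(m * Q)) := by
        rw [Finset.sum_mul]
        refine Finset.sum_congr rfl fun z hz => ?_
        rw [(Finset.mem_filter.1 hz).2, sub_eq_add_neg, Real.exp_add]
    _ ≤ b m := mul_le_mul_of_nonneg_right hle (Real.exp_pos _).le

/-- Above the pressure, the weights of all orbit segments from `a` to `b` with a given future
have a finite sum, bounded uniformly in that future. -/
lemma DistortionBound.exists_sum_segments_le {B : ℝ} (hB : DistortionBound M φ B)
    (htrans : TopTransitive M) (hF : FProperty M) {a : ℕ} (b : ℕ) {P Q : ℝ}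
    (hP : pressureAt M φ a = (P : EReal)) (hPQ : P < Q) :
    ∃ C : ℝ, ∀ (X : Pt) (H : Finset (Pt × ℕ)),
      (∀ z ∈ H, isAdmissible M z.1 ∧ z.1 0 = a ∧ z.1 z.2 = b ∧ shiftMap^[z.2] z.1 = X) →
      ∑ z ∈ H, exp (birkhoff φ z.2 z.1 - z.2 * Q) ≤ C := by
  classical
  obtain ⟨C, hC⟩ := hF.exists_sum_perSet_le hP hPQ
  obtain ⟨r, y, hy, hr, hy0, hyr⟩ := htrans.exists_path b a
  refine ⟨exp (2 * B - birkhoff φ r y + r * Q) * C, fun X H hH => ?_⟩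
  let f : Pt × ℕ → Pt × ℕ := fun z => (closeUp z.2 r z.1 y, z.2 + r)
  have hstart : ∀ z ∈ H, z.1 z.2 = y 0 := fun z hz => (hH z hz).2.2.1.trans hy0.symm
  have hend : ∀ z ∈ H, y r = z.1 0 := fun z hz => hyr.trans (hH z hz).2.1.symm
  have hinj : Set.InjOn f H := by
    rintro ⟨z, m⟩ hz ⟨z', m'⟩ hz' h
    have hm : m + r = m' + r := congrArg Prod.snd h
    obtain rfl : m = m' := by omega
    have hp : closeUp m r z y = closeUp m r z' y := congrArg Prod.fst h
    refine Prod.ext (funext fun t => ?_) rfl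
    rcases le_total t m with ht | ht
    · rw [← closeUp_of_le (hstart _ hz) (hend _ hz) ht, hp,
        closeUp_of_le (hstart _ hz') (hend _ hz') ht]
    · have hX : shiftMap^[m] z = shiftMap^[m] z' :=
        (hH _ hz).2.2.2.trans (hH _ hz').2.2.2.symm
      have := congrFun hX (t - m)
      rwa [shiftMap_iterate_apply, shiftMap_iterate_apply, Nat.sub_add_cancel ht] at this
  have hle := hC (H.image f) fun p hp => by
    obtain ⟨z, hz, rfl⟩ := Finset.mem_image.1 hp
    have := closeUp_mem_perSet (hH z hz).1 hy hr (hstart z hz) (hend z hz)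
    rw [(hH z hz).2.1] at this
    exact ⟨Nat.add_pos_right _ hr, this⟩
  rw [Finset.sum_image hinj] at hle
  refine le_trans ?_ (mul_le_mul_of_nonneg_left hle (Real.exp_pos _).le)
  rw [Finset.mul_sum]
  refine Finset.sum_le_sum fun z hz => ?_
  rw [← Real.exp_add, Real.exp_le_exp]
  have := hB.le_birkhoff_closeUp (hH z hz).1 hy hr (hstart z hz) (hend z hz)
  simp only [f, Nat.cast_add]
  linarith

/-- The Birkhoff sums of length `n` at the points related to `n` by `R` are at most `n * Q`, up to
an additive constant. -/
def LinearBound (M : ℕ → ℕ → Prop) (φ : Pt → ℝ) (Q : ℝ) (R : ℕ → Pt → Prop) : Prop :=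
  ∃ C : ℝ, ∀ n x, isAdmissible M x → R n x → birkhoff φ n x ≤ C + n * Q

/-- A linear bound with some slope below `P`. -/
def StrictLinearBound (M : ℕ → ℕ → Prop) (φ : Pt → ℝ) (P : ℝ) (R : ℕ → Pt → Prop) : Prop :=
  ∃ ε > 0, LinearBound M φ (P - ε) R

section bounds

variable {P Q : ℝ} {R R' : ℕ → Pt → Prop}

lemma LinearBound.mono {Q' : ℝ} (h : LinearBound M φ Q R) (hQ : Q ≤ Q')
    (hR : ∀ n x, R' n x → R n x) : LinearBound M φ Q' R' := by
  obtain ⟨C, hC⟩ := h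
  refine ⟨C, fun n x hx hr => (hC n x hx (hR n x hr)).trans ?_⟩
  gcongr

lemma LinearBound.or (h : LinearBound M φ Q R) (h' : LinearBound M φ Q R') :
    LinearBound M φ Q fun n x => R n x ∨ R' n x := by
  obtain ⟨C, hC⟩ := h
  obtain ⟨C', hC'⟩ := h'
  refine ⟨max C C', fun n x hx hr => ?_⟩
  rcases hr with hr | hr
  · exact (hC n x hx hr).trans (by gcongr; exact le_max_left _ _)
  · exact (hC' n x hx hr).trans (by gcongr; exact le_max_right _ _)

lemma LinearBound.exists_le {R : ℕ → ℕ → Pt → Prop} {q : ℕ}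
    (h : ∀ a ≤ q, LinearBound M φ Q (R a)) : LinearBound M φ Q fun n x => ∃ a ≤ q, R a n x := by
  induction q with
  | zero => exact (h 0 le_rfl).mono le_rfl (by simp)
  | succ q ih =>
    refine ((ih fun a ha => h a (by omega)).or (h (q + 1) le_rfl)).mono le_rfl ?_
    rintro n x ⟨a, ha, hr⟩
    rcases Nat.le_succ_iff.1 ha with ha | rfl
    exacts [Or.inl ⟨a, ha, hr⟩, Or.inr hr]

lemma StrictLinearBound.mono (h : StrictLinearBound M φ P R) (hR : ∀ n x, R' n x → R n x) :
    StrictLinearBound M φ P R' := by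
  obtain ⟨ε, hε, h⟩ := h
  exact ⟨ε, hε, h.mono le_rfl hR⟩

lemma StrictLinearBound.or (h : StrictLinearBound M φ P R) (h' : StrictLinearBound M φ P R') :
    StrictLinearBound M φ P fun n x => R n x ∨ R' n x := by
  obtain ⟨ε, hε, h⟩ := h
  obtain ⟨ε', hε', h'⟩ := h'
  refine ⟨min ε ε', lt_min hε hε', LinearBound.or (h.mono ?_ fun _ _ => id)
    (h'.mono ?_ fun _ _ => id)⟩
  · linarith [min_le_left ε ε']
  · linarith [min_le_right ε ε']

lemma StrictLinearBound.exists_le {R : ℕ → ℕ → Pt → Prop} {q : ℕ}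
    (h : ∀ a ≤ q, StrictLinearBound M φ P (R a)) :
    StrictLinearBound M φ P fun n x => ∃ a ≤ q, R a n x := by
  have h' : ∀ a, ∃ ε > 0, a ≤ q → LinearBound M φ (P - ε) (R a) := by
    intro a
    by_cases ha : a ≤ q
    · obtain ⟨ε, hε, h⟩ := h a ha
      exact ⟨ε, hε, fun _ => h⟩
    · exact ⟨1, one_pos, fun h => absurd h ha⟩
  choose ε hε h' using h'
  obtain ⟨a₀, -, hmin⟩ := Finset.exists_min_image (Finset.range (q + 1)) ε ⟨0, by simp⟩
  refine ⟨ε a₀, hε a₀, LinearBound.exists_le fun a ha => (h' a ha).mono ?_ fun _ _ => id⟩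
  linarith [hmin a (Finset.mem_range.2 (by omega))]

end bounds

section orbits

variable {B P : ℝ}

/-- A linear bound for returns to the state `0` propagates to all states. -/
lemma DistortionBound.linearBound_of_zero (hB : DistortionBound M φ B) (htrans : TopTransitive M)
    {Q : ℝ} (h : LinearBound M φ Q fun n x => x 0 ≤ 0 ∧ x n ≤ 0) (q : ℕ) :
    LinearBound M φ Q fun n x => x 0 ≤ q ∧ x n ≤ q := by
  obtain ⟨C, hC⟩ := h
  have key : ∀ a ≤ q, ∀ b ≤ q, LinearBound M φ Q fun n x => x 0 = a ∧ x n = b := by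
    intro a _ b _
    obtain ⟨r, y, hy, -, hy0, hyr⟩ := htrans.exists_path 0 a
    obtain ⟨k, w, hw, -, hw0, hwk⟩ := htrans.exists_path b 0
    refine ⟨C + (r + k) * Q - birkhoff φ r y - birkhoff φ k w + 2 * B, fun n x hx hr => ?_⟩
    have h1 : x n = w 0 := hr.2.trans hw0.symm
    have h2 : y r = splice n x w 0 := by rw [splice_of_le h1 (Nat.zero_le _), hyr, hr.1]
    have e1 := hB.le_birkhoff_splice hx hw h1 k
    have e2 := hB.le_birkhoff_splice hy (hx.splice hw h1) h2 (n + k)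
    have e3 := hC (r + (n + k)) _ (hy.splice (hx.splice hw h1) h2)
      ⟨by rw [splice_of_le h2 (Nat.zero_le _), hy0], by
        rw [splice_of_ge _ _ (Nat.le_add_right r _), Nat.add_sub_cancel_left,
          splice_of_ge _ _ (Nat.le_add_right n _), Nat.add_sub_cancel_left, hwk]⟩
    push_cast at e3
    linarith
  refine (LinearBound.exists_le fun a ha => LinearBound.exists_le (key a ha)).mono le_rfl ?_
  exact fun n x hx => ⟨x 0, hx.1, x n, hx.2, rfl, rfl⟩

/-- Above the pressure, Birkhoff sums between boundedly many states are linearly bounded. -/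
lemma DistortionBound.linearBound_of_pressure_lt (hB : DistortionBound M φ B)
    (htrans : TopTransitive M) (hF : FProperty M) (hP : ∀ a, pressureAt M φ a = (P : EReal))
    {Q : ℝ} (hPQ : P < Q) (q : ℕ) : LinearBound M φ Q fun n x => x 0 ≤ q ∧ x n ≤ q := by
  refine hB.linearBound_of_zero htrans ?_ q
  obtain ⟨C, hC⟩ := hB.exists_sum_segments_le htrans hF 0 (hP 0) hPQ
  refine ⟨Real.log C, fun n x hx hr => ?_⟩
  have h := hC (shiftMap^[n] x) {(x, n)} (by
    simpa using ⟨hx, Nat.le_zero.1 hr.1, Nat.le_zero.1 hr.2⟩)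
  rw [Finset.sum_singleton] at h
  have := (Real.le_log_iff_exp_le ((Real.exp_pos _).trans_le h)).2 h
  linarith

open Classical in
/-- Orbit segments with a positive frequency of times at which a loop can be inserted have
Birkhoff averages bounded away from the pressure. -/
lemma DistortionBound.strictLinearBound_of_insertions (hB : DistortionBound M φ B)
    (htrans : TopTransitive M) (hF : FProperty M) {a l c d : ℕ} {u : Pt}
    (hP : pressureAt M φ c = (P : EReal)) (hu : IsFirstLoop M a l u) {κ : ℝ} (hκ : 0 < κ) :
    StrictLinearBound M φ P fun n x => x 0 = c ∧ x n = d ∧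
      κ * n ≤ ((Finset.range (n + 1)).filter fun k => x k = a ∧ ¬ Reads l u x k).card := by
  set e := exp (birkhoff φ l u - 2 * B - l * (P + 1)) with he
  have he0 : 0 < e := Real.exp_pos _
  set L := Real.log (1 + e) with hL
  have hL0 : 0 < L := Real.log_pos (by linarith)
  have hη : 0 < min 1 (κ * L / 2) := lt_min one_pos (by positivity)
  set η := min 1 (κ * L / 2)
  obtain ⟨C, hC⟩ := hB.exists_sum_segments_le htrans hF d hP (show P < P + η by linarith)
  refine ⟨κ * L / 2, by positivity, Real.log C, fun n x hx ⟨hx0, hxn, hcard⟩ => ?_⟩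
  set s := (Finset.range (n + 1)).filter fun k => x k = a ∧ ¬ Reads l u x k
  have hs : ∀ i ∈ s, i ≤ n ∧ x i = a ∧ ¬ Reads l u x i := fun i hi => by
    obtain ⟨h1, h2⟩ := Finset.mem_filter.1 hi
    exact ⟨Nat.lt_succ_iff.1 (Finset.mem_range.1 h1), h2⟩
  obtain ⟨H, hH, hsum⟩ := hB.exists_insertions hu hx n (P + η) s hs
  have hle := hsum.trans (hC _ H fun z hz => by
    obtain ⟨h1, -, h3, h4⟩ := hH z hz
    refine ⟨h1, (h4 0 fun _ _ => Nat.zero_le _).trans hx0, ?_, h3⟩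
    have := congrFun h3 0
    rw [shiftMap_iterate_apply, shiftMap_iterate_apply, zero_add, zero_add] at this
    exact this.trans hxn)
  have hee : e ≤ exp (birkhoff φ l u - 2 * B - l * (P + η)) := by
    rw [he, Real.exp_le_exp]
    have : (l : ℝ) * (P + η) ≤ l * (P + 1) := by
      gcongr
      exact min_le_left _ _
    linarith
  have hpow : (1 + e) ^ s.card * exp (birkhoff φ n x - n * (P + η)) ≤ C :=
    le_trans (by gcongr) hle
  have hlog := Real.log_le_log (by positivity) hpow
  rw [Real.log_mul (by positivity) (Real.exp_pos _).ne', Real.log_pow, Real.log_exp] at hlog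
  have h1 : (n : ℝ) * η ≤ n * (κ * L / 2) := by
    gcongr
    exact min_le_right _ _
  have h2 : κ * n * L ≤ s.card * L := by gcongr
  rw [← hL] at hlog
  linarith

lemma DistortionBound.strictLinearBound_of_visits (hB : DistortionBound M φ B)
    (htrans : TopTransitive M) (hF : FProperty M) (hP : ∀ a, pressureAt M φ a = (P : EReal))
    (q a : ℕ) {κ : ℝ} (hκ : 0 < κ) :
    StrictLinearBound M φ P fun n x => x 0 ≤ q ∧ x n ≤ q ∧
      κ * n ≤ ((Finset.range (n + 1)).filter fun k => x k = a).card := by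
  classical
  obtain ⟨l, l', u, u', hu, hu', hne⟩ := htrans.exists_two_isFirstLoop a
  have hκ2 : 0 < κ / 2 := half_pos hκ
  refine (StrictLinearBound.exists_le (q := q) fun c _ =>
    StrictLinearBound.exists_le (q := q) fun d _ =>
      (hB.strictLinearBound_of_insertions htrans hF (d := d) (hP c) hu hκ2).or
        (hB.strictLinearBound_of_insertions htrans hF (d := d) (hP c) hu' hκ2)).mono ?_
  rintro n x ⟨h0, hn, hcard⟩
  refine ⟨x 0, h0, x n, hn, ?_⟩
  have hsub : ((Finset.range (n + 1)).filter fun k => x k = a) ⊆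
      ((Finset.range (n + 1)).filter fun k => x k = a ∧ ¬ Reads l u x k) ∪
        ((Finset.range (n + 1)).filter fun k => x k = a ∧ ¬ Reads l' u' x k) := by
    intro k hk
    obtain ⟨hk, hka⟩ := Finset.mem_filter.1 hk
    have := hne x k
    simp only [Finset.mem_union, Finset.mem_filter]
    tauto
  have hle : (((Finset.range (n + 1)).filter fun k => x k = a).card : ℝ) ≤
      ((Finset.range (n + 1)).filter fun k => x k = a ∧ ¬ Reads l u x k).card +
        ((Finset.range (n + 1)).filter fun k => x k = a ∧ ¬ Reads l' u' x k).card := by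
    exact_mod_cast (Finset.card_le_card hsub).trans (Finset.card_union_le _ _)
  by_contra! hcon
  linarith [hcon.1 rfl rfl, hcon.2 rfl rfl]

lemma DistortionBound.strictLinearBound_of_frequent (hB : DistortionBound M φ B)
    (htrans : TopTransitive M) (hF : FProperty M) (hP : ∀ a, pressureAt M φ a = (P : EReal))
    (q : ℕ) {N : ℕ} (hN : 0 < N) :
    StrictLinearBound M φ P fun n x => x 0 ≤ q ∧ x n ≤ q ∧
      ((n + 1 : ℝ) / N < ((Finset.range (n + 1)).filter fun k => x k ≤ q).card) := by
  classical
  have hN' : (0 : ℝ) < N := by exact_mod_cast hN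
  have hκ : (0 : ℝ) < 1 / (N * (q + 1)) := by positivity
  refine (StrictLinearBound.exists_le (q := q) fun a _ =>
    hB.strictLinearBound_of_visits htrans hF hP q a hκ).mono ?_
  rintro n x ⟨h0, hn, hcard⟩
  by_contra! hcon
  have hcount : ((Finset.range (n + 1)).filter fun k => x k ≤ q).card =
      ∑ a ∈ Finset.range (q + 1), ((Finset.range (n + 1)).filter fun k => x k = a).card := by
    rw [Finset.card_eq_sum_card_fiberwise (f := x) (t := Finset.range (q + 1))]
    · refine Finset.sum_congr rfl fun a ha => ?_
      have := Finset.mem_range.1 ha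
      rw [Finset.filter_filter]
      congr 1
      refine Finset.filter_congr fun k _ => ?_
      constructor
      · exact fun h => h.2
      · exact fun h => ⟨by omega, h⟩
    · intro k hk
      have := (Finset.mem_filter.1 hk).2
      simpa [Nat.lt_succ_iff] using this
  have hsum : ∑ a ∈ Finset.range (q + 1),
      (((Finset.range (n + 1)).filter fun k => x k = a).card : ℝ) ≤
        ∑ _a ∈ Finset.range (q + 1), 1 / ((N : ℝ) * (q + 1)) * n :=
    Finset.sum_le_sum fun a ha =>
      (hcon a (Nat.lt_succ_iff.1 (Finset.mem_range.1 ha)) h0 hn).le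
  rw [hcount, Nat.cast_sum] at hcard
  have hval : ∑ _a ∈ Finset.range (q + 1), 1 / ((N : ℝ) * (q + 1)) * n = n / N := by
    rw [Finset.sum_const, Finset.card_range, nsmul_eq_mul]
    push_cast
    field_simp
  have : (n : ℝ) / N ≤ (n + 1) / N := by gcongr; linarith
  linarith

end orbits

section equivalences

variable {B P : ℝ}

lemma birkhoff_nat_mul_of_periodic (φ : Pt → ℝ) {n : ℕ} {x : Pt} (hx : shiftMap^[n] x = x)
    (k : ℕ) : birkhoff φ (k * n) x = k * birkhoff φ n x := by
  induction k with
  | zero => simp [birkhoff]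
  | succ k ih =>
    have hk : shiftMap^[k * n] x = x := by
      rw [mul_comm, Function.iterate_mul]
      exact Function.iterate_fixed hx k
    rw [Nat.succ_mul, birkhoff_add, ih, hk]
    push_cast
    ring

lemma DistortionBound.linearBound_iff (hB : DistortionBound M φ B) (htrans : TopTransitive M) :
    (∀ q : ℕ, ∃ C ε : ℝ, 0 < ε ∧ ∀ n : ℕ, ∀ x : Pt, isAdmissible M x →
      x 0 ≤ q → x n ≤ q → birkhoff φ n x ≤ C + n * (P - ε)) ↔
    ∃ ε > 0, ∀ q, LinearBound M φ (P - ε) fun n x => x 0 ≤ q ∧ x n ≤ q := by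
  constructor
  · intro h
    obtain ⟨C, ε, hε, h⟩ := h 0
    exact ⟨ε, hε, hB.linearBound_of_zero htrans ⟨C, fun n x hx hr => h n x hx hr.1 hr.2⟩⟩
  · rintro ⟨ε, hε, h⟩ q
    obtain ⟨C, hC⟩ := h q
    exact ⟨C, ε, hε, fun n x hx h0 hn => hC n x hx ⟨h0, hn⟩⟩

lemma DistortionBound.chiPer_lt_iff (hB : DistortionBound M φ B) (htrans : TopTransitive M) :
    chiPer M φ < (P : EReal) ↔
      ∃ ε > 0, ∀ q, LinearBound M φ (P - ε) fun n x => x 0 ≤ q ∧ x n ≤ q := by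
  constructor
  · intro h
    obtain ⟨c, hc, hcP⟩ := EReal.lt_iff_exists_real_btwn.1 h
    refine ⟨P - c, sub_pos.2 (EReal.coe_lt_coe_iff.1 hcP), hB.linearBound_of_zero htrans ?_⟩
    obtain ⟨r, y, hy, hr, hy0, hyr⟩ := htrans.exists_path 0 0
    refine ⟨r * c + 2 * B - birkhoff φ r y, fun n x hx ⟨hx0, hxn⟩ => ?_⟩
    have h1 : x n = y 0 := (Nat.le_zero.1 hxn).trans hy0.symm
    have h2 : y r = x 0 := hyr.trans (Nat.le_zero.1 hx0).symm
    have hp := closeUp_mem_perSet hx hy hr h1 h2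
    have hle := (le_iSup (fun p : {p : Pt × ℕ // isAdmissible M p.1 ∧ 0 < p.2 ∧
      shiftMap^[p.2] p.1 = p.1} => ((birkhoff φ p.1.2 p.1.1 / (p.1.2 : ℝ) : ℝ) : EReal))
      ⟨(closeUp n r x y, n + r), hp.1, Nat.add_pos_right n hr, hp.2.1⟩).trans hc.le
    have hpos : (0 : ℝ) < ((n + r : ℕ) : ℝ) := by exact_mod_cast Nat.add_pos_right n hr
    have hle := (div_le_iff₀ hpos).1 (EReal.coe_le_coe_iff.1 hle)
    have := hB.le_birkhoff_closeUp hx hy hr h1 h2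
    push_cast at hle
    linarith
  · rintro ⟨ε, hε, h⟩
    refine lt_of_le_of_lt (iSup_le (a := ((P - ε : ℝ) : EReal)) ?_)
      (EReal.coe_lt_coe_iff.2 (by linarith))
    rintro ⟨⟨x, n⟩, hx, hn, hper⟩
    obtain ⟨C, hC⟩ := h (x 0)
    rw [EReal.coe_le_coe_iff]
    have hn' : (0 : ℝ) < n := by exact_mod_cast hn
    rw [div_le_iff₀ hn']
    by_contra! hlt
    obtain ⟨k, hk⟩ := exists_nat_gt (C / (birkhoff φ n x - (P - ε) * n))
    rw [div_lt_iff₀ (sub_pos.2 hlt)] at hk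
    have hkn : shiftMap^[k * n] x = x := by
      rw [mul_comm, Function.iterate_mul]
      exact Function.iterate_fixed hper k
    have h0 := congrFun hkn 0
    rw [shiftMap_iterate_apply, zero_add] at h0
    have := hC (k * n) x hx ⟨le_rfl, h0.le⟩
    rw [birkhoff_nat_mul_of_periodic φ hper] at this
    push_cast at this
    linarith

lemma deltaInf_lt_of_linearBound {ε : ℝ} (hε : 0 < ε)
    (h : ∀ q, LinearBound M φ (P - ε) fun n x => x 0 ≤ q ∧ x n ≤ q) :
    deltaInf M φ < (P : EReal) := by
  have hz : ∀ q N, limsup (fun n : ℕ => zPhi M φ n N q) atTop ≤ ((P - ε / 2 : ℝ) : EReal) := by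
    intro q N
    obtain ⟨C, hC⟩ := h q
    refine limsup_le_of_le (h := ?_)
    have hlarge : ∀ᶠ n : ℕ in atTop, C / (ε / 2) ≤ (n : ℝ) :=
      tendsto_natCast_atTop_atTop.eventually_ge_atTop _
    filter_upwards [hlarge, eventually_gt_atTop 0] with n hn hn0
    refine iSup_le ?_
    rintro ⟨x, hx, h0, h1, -⟩
    have hn0' : (0 : ℝ) < n := by exact_mod_cast hn0
    rw [EReal.coe_le_coe_iff, div_le_iff₀ hn0']
    have := hC n x hx ⟨h0, h1⟩
    rw [div_le_iff₀ (half_pos hε)] at hn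
    linarith
  have hconst : deltaInf M φ ≤ ((P - ε / 2 : ℝ) : EReal) := by
    calc deltaInf M φ
        ≤ liminf (fun _ : ℕ => liminf (fun _ : ℕ => ((P - ε / 2 : ℝ) : EReal)) atTop) atTop :=
          liminf_le_liminf (Eventually.of_forall fun q =>
            liminf_le_liminf (Eventually.of_forall fun N => hz q N))
      _ = ((P - ε / 2 : ℝ) : EReal) := by simp
  exact hconst.trans_lt (EReal.coe_lt_coe_iff.2 (by linarith))

lemma DistortionBound.linearBound_of_deltaInf_lt (hB : DistortionBound M φ B)
    (htrans : TopTransitive M) (hF : FProperty M) (hP : ∀ a, pressureAt M φ a = (P : EReal))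
    (h : deltaInf M φ < (P : EReal)) :
    ∃ ε > 0, ∀ q, LinearBound M φ (P - ε) fun n x => x 0 ≤ q ∧ x n ≤ q := by
  obtain ⟨c, hc, hcP⟩ := EReal.lt_iff_exists_real_btwn.1 h
  have hcP := EReal.coe_lt_coe_iff.1 hcP
  obtain ⟨q, hq⟩ := (frequently_lt_of_liminf_lt (h := hc)).exists
  obtain ⟨N, hN, hN0⟩ :=
    ((frequently_lt_of_liminf_lt (h := hq)).and_eventually (eventually_gt_atTop 0)).exists
  obtain ⟨m, hm⟩ := eventually_atTop.1 (eventually_lt_of_limsup_lt hN)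
  have hfreq := hB.strictLinearBound_of_frequent htrans hF hP q hN0
  have hshort : StrictLinearBound M φ P fun n x => x 0 ≤ q ∧ x n ≤ q ∧ n ≤ m := by
    obtain ⟨C, hC⟩ := hB.linearBound_of_pressure_lt htrans hF hP (lt_add_one P) q
    refine ⟨1, one_pos, C + 2 * m, fun n x hx ⟨h0, h1, h2⟩ => ?_⟩
    have := hC n x hx ⟨h0, h1⟩
    have h2' : (n : ℝ) ≤ m := by exact_mod_cast h2
    linarith
  have hrare : StrictLinearBound M φ P fun n x => inBSet M n N q x ∧ m < n := by
    refine ⟨P - c, sub_pos.2 hcP, 0, fun n x _ ⟨hb, hmn⟩ => ?_⟩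
    have hle := (le_iSup (fun x : {x : Pt // inBSet M n N q x} =>
      ((birkhoff φ n x.1 / (n : ℝ) : ℝ) : EReal)) ⟨x, hb⟩).trans (hm n hmn.le).le
    have hn0 : (0 : ℝ) < n := by exact_mod_cast Nat.zero_lt_of_lt hmn
    have := (div_le_iff₀ hn0).1 (EReal.coe_le_coe_iff.1 hle)
    linarith
  have hall : StrictLinearBound M φ P fun n x => isAdmissible M x ∧ x 0 ≤ q ∧ x n ≤ q := by
    refine (hfreq.or (hshort.or hrare)).mono fun n x ⟨hx, h0, h1⟩ => ?_
    by_cases hnm : n ≤ m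
    · exact Or.inr (Or.inl ⟨h0, h1, hnm⟩)
    · by_cases hcard : (n + 1 : ℝ) / N < ((Finset.range (n + 1)).filter fun k => x k ≤ q).card
      · exact Or.inl ⟨h0, h1, hcard⟩
      · exact Or.inr (Or.inr ⟨⟨hx, h0, h1, not_lt.1 hcard⟩, not_le.1 hnm⟩)
  obtain ⟨ε, hε, C, hC⟩ := hall
  refine ⟨ε, hε, hB.linearBound_of_zero htrans ⟨C, fun n x hx ⟨h0, h1⟩ => ?_⟩⟩
  exact hC n x hx ⟨hx, h0.trans (Nat.zero_le q), h1.trans (Nat.zero_le q)⟩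

end equivalences

end

end CMS

/-- Theorem `thm:contract`.
For a topologically transitive countable Markov shift with the F-property and a
potential `φ` with summable variations and finite Gurevich pressure `P = P(φ)`
(independent of the base state by transitivity), the conditions (UCS), (CRC)
and (CI) are equivalent. -/
theorem UCS_iff_CRC_iff_CI
    (M : ℕ → ℕ → Prop) (φ : Pt → ℝ)
    (htrans : TopTransitive M) (hF : FProperty M)
    (hsum : SummableVariations M φ)
    (P : ℝ) (hP : ∀ a : ℕ, pressureAt M φ a = (P : EReal)) :
    ((chiPer M φ < (P : EReal)) ↔
      (∀ q : ℕ, ∃ C ε : ℝ, 0 < ε ∧ ∀ n : ℕ, ∀ x : Pt, isAdmissible M x →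
        x 0 ≤ q → x n ≤ q → birkhoff φ n x ≤ C + n * (P - ε))) ∧
    ((∀ q : ℕ, ∃ C ε : ℝ, 0 < ε ∧ ∀ n : ℕ, ∀ x : Pt, isAdmissible M x →
        x 0 ≤ q → x n ≤ q → birkhoff φ n x ≤ C + n * (P - ε)) ↔
      (deltaInf M φ < (P : EReal))) := by
  obtain ⟨B, hB⟩ := hsum.exists_distortionBound
  rw [hB.chiPer_lt_iff htrans, hB.linearBound_iff htrans]
  exact ⟨Iff.rfl, fun ⟨_, hε, h⟩ => deltaInf_lt_of_linearBound hε h,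
    hB.linearBound_of_deltaInf_lt htrans hF hP⟩
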